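/- arXiv:2603.27047 — 8 statements merged into one kernel-verified Lean document; each statement's English description precedes it below -/
import Mathlib

section
/- Let T be a Hausdorff, uniquely arcwise connected topological space. Let X ⊆ T be a nonempty, closed, path-connected subset, and let y ∈ T. Then there exists a unique point c ∈ X with the following property: for every x ∈ X and every injective continuous map p : [0,1] → T with p(0) = y and p(1) = x, the point c lies in the range of p. (c is called the point of X closest to y.) -/
open Set Topology unitInterval

/-- A continuous map `f` on the unit interval admits, for any two points `p ≤ q` with distinct values,
a continuous monotone function separating `p` and `q` that is constant on the fibers of `f`,
provided the fibers of `f` are intervals. -/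
lemma exists_monotone_separating {T : Type*} [TopologicalSpace T] [T2Space T] {f : I → T}
    (hf : Continuous f) (hfib : ∀ x z y, x ≤ z → z ≤ y → f x = f y → f z = f x) (p q : I) :
    ∃ F : I → ℝ, Continuous F ∧ Monotone F ∧ (∀ s, 0 ≤ F s ∧ F s ≤ 1) ∧
      (∀ s t, f s = f t → F s = F t) ∧ (p ≤ q → f p ≠ f q → F p = 0 ∧ F q = 1) := by
  by_cases hpq : p ≤ q ∧ f p ≠ f q
  swap
  · exact ⟨fun _ => 0, continuous_const, monotone_const, fun _ => by simp, fun _ _ _ => rfl,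
      fun h1 h2 => absurd ⟨h1, h2⟩ hpq⟩
  obtain ⟨hle, hne⟩ := hpq
  let K := range f
  have : CompactSpace K := isCompact_iff_compactSpace.1 (isCompact_range hf)
  let f' : I → K := rangeFactorization f
  have hf' : Continuous f' := hf.subtype_mk _
  have hA : IsClosed (f' '' Iic p) := (isClosed_Iic.isCompact.image hf').isClosed
  have hB : IsClosed ({f' q} : Set K) := isClosed_singleton
  have hd : Disjoint (f' '' Iic p) {f' q} := by
    rw [disjoint_singleton_right]
    rintro ⟨r, hr, hrq⟩
    have hrq' : f r = f q := congrArg Subtype.val hrq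
    exact hne ((hfib r p q hr hle hrq').trans hrq')
  obtain ⟨g, hg0, hg1, hg01⟩ := exists_continuous_zero_one_of_isClosed hA hB hd
  let k : I → ℝ := fun r => g (f' r)
  have hk : Continuous k := g.continuous.comp hf'
  have hkeq : ∀ s t, f s = f t → k s = k t := fun s t h => by
    have : f' s = f' t := Subtype.ext h
    simp only [k, this]
  have hkb : ∀ s, BddAbove (k '' Iic s) := fun s => ⟨1, by
    rintro _ ⟨r, -, rfl⟩; exact (hg01 _).2⟩
  have hkn : ∀ s, (k '' Iic s).Nonempty := fun s => ⟨k s, s, mem_Iic.2 le_rfl, rfl⟩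
  have hmono : Monotone fun s => sSup (k '' Iic s) := fun s t hst =>
    csSup_le_csSup (hkb t) (hkn s) (image_mono (Iic_subset_Iic.2 hst))
  refine ⟨fun s => sSup (k '' Iic s), ?_, hmono, ?_, ?_, ?_⟩
  · have : (fun s => sSup (k '' Iic s)) = fun s => sSup ((fun r => k (min s r)) '' univ) := by
      funext s
      congr 1
      ext v
      constructor
      · rintro ⟨r, hr, rfl⟩
        exact ⟨r, trivial, by simp only [min_eq_right (mem_Iic.1 hr)]⟩
      · rintro ⟨r, -, rfl⟩
        exact ⟨min s r, mem_Iic.2 (min_le_left _ _), rfl⟩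
    rw [this]
    exact isCompact_univ.continuous_sSup (f := fun s r : I => k (min s r))
      (hk.comp (continuous_fst.min continuous_snd))
  · intro s
    exact ⟨(hg01 (f' s)).1.trans (le_csSup (hkb s) ⟨s, mem_Iic.2 le_rfl, rfl⟩),
      csSup_le (hkn s) (by rintro _ ⟨r, -, rfl⟩; exact (hg01 _).2)⟩
  · have key : ∀ s t, s ≤ t → f s = f t → sSup (k '' Iic s) = sSup (k '' Iic t) := by
      intro s t hst h
      refine le_antisymm (hmono hst) (csSup_le (hkn t) ?_)
      rintro _ ⟨r, hr, rfl⟩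
      rcases le_total r s with hrs | hsr
      · exact le_csSup (hkb s) ⟨r, hrs, rfl⟩
      · exact le_csSup (hkb s) ⟨s, mem_Iic.2 le_rfl, (hkeq r s (hfib s r t hsr hr h)).symm⟩
    intro s t h
    rcases le_total s t with hst | hst
    · exact key s t hst h
    · exact (key t s hst h.symm).symm
  · intro _ _
    constructor
    · have : k '' Iic p = {0} := by
        refine (hkn p).subset_singleton_iff.1 ?_
        rintro _ ⟨r, hr, rfl⟩
        exact hg0 ⟨r, hr, rfl⟩
      simp only [this, csSup_singleton]
    · refine le_antisymm (csSup_le (hkn q) (by rintro _ ⟨r, -, rfl⟩; exact (hg01 _).2)) ?_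
      have : k q = 1 := hg1 rfl
      rw [← this]
      exact le_csSup (hkb q) ⟨q, mem_Iic.2 le_rfl, rfl⟩

/-- Between two points with distinct values of `f`, a dense sequence has an ordered pair of terms with
distinct values. -/
lemma exists_dense_pair {T : Type*} [TopologicalSpace T] [T2Space T] {f : I → T}
    (hf : Continuous f) {d : ℕ → I} (hd : DenseRange d) {s t : I} (hst : s < t)
    (h : f s ≠ f t) : ∃ i j, s ≤ d i ∧ d i ≤ d j ∧ d j ≤ t ∧ f (d i) ≠ f (d j) := by
  obtain ⟨U, V, hU, hV, hsU, htV, hUV⟩ := t2_separation h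
  obtain ⟨m, hsm, hmt⟩ := exists_between hst
  obtain ⟨u, hu, hsu⟩ := exists_Ico_subset_of_mem_nhds ((hU.preimage hf).mem_nhds hsU) ⟨t, hst⟩
  obtain ⟨v, hv, hvt⟩ := exists_Ioc_subset_of_mem_nhds ((hV.preimage hf).mem_nhds htV) ⟨s, hst⟩
  obtain ⟨i, hi⟩ := hd.exists_mem_open isOpen_Ioo (nonempty_Ioo.2 (lt_min hu hsm))
  obtain ⟨j, hj⟩ := hd.exists_mem_open isOpen_Ioo (nonempty_Ioo.2 (max_lt hv hmt))
  have hi2 := lt_min_iff.1 hi.2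
  have hj1 := max_lt_iff.1 hj.1
  refine ⟨i, j, hi.1.le, (hi2.2.trans hj1.2).le, hj.2.le, fun he => ?_⟩
  have h1 : f (d i) ∈ U := hsu ⟨hi.1.le, hi2.1⟩
  have h2 : f (d j) ∈ V := hvt ⟨hj1.1, hj.2.le⟩
  exact disjoint_left.1 hUV h1 (he ▸ h2)

/-- A path in a Hausdorff space whose fibers are intervals can be reparametrized to an arc. -/
lemma exists_injective_of_ordConnected_fibers {T : Type*} [TopologicalSpace T] [T2Space T]
    {f : I → T} (hf : Continuous f)
    (hfib : ∀ x z y, x ≤ z → z ≤ y → f x = f y → f z = f x) (hne : f 0 ≠ f 1) :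
    ∃ p : I → T, Continuous p ∧ Function.Injective p ∧ p 0 = f 0 ∧ p 1 = f 1 ∧
      range p ⊆ range f := by
  choose F hFc hFm hF01 hFeq hFsep using exists_monotone_separating hf hfib
  let d := TopologicalSpace.denseSeq I
  have hd : DenseRange d := TopologicalSpace.denseRange_denseSeq I
  let w : ℕ × ℕ → ℝ := fun n => (1 / 2) ^ Encodable.encode n
  have hw : Summable w := summable_geometric_two_encode
  have hwpos : ∀ n, 0 < w n := fun n => by positivity
  let G : ℕ × ℕ → I → ℝ := fun n s => w n * F (d n.1) (d n.2) s
  have hGnn : ∀ n s, 0 ≤ G n s := fun n s => mul_nonneg (hwpos n).le (hF01 _ _ s).1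
  have hGle : ∀ n s, G n s ≤ w n := fun n s =>
    mul_le_of_le_one_right (hwpos n).le (hF01 _ _ s).2
  have hGs : ∀ s, Summable fun n => G n s := fun s =>
    Summable.of_nonneg_of_le (fun n => hGnn n s) (fun n => hGle n s) hw
  let H : I → ℝ := fun s => ∑' n, G n s
  have hHc : Continuous H := by
    refine continuous_tsum (fun n => continuous_const.mul (hFc _ _)) hw fun n s => ?_
    rw [Real.norm_of_nonneg (hGnn n s)]
    exact hGle n s
  have hGm : ∀ n s t, s ≤ t → G n s ≤ G n t := fun n s t hst =>
    mul_le_mul_of_nonneg_left (hFm _ _ hst) (hwpos n).le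
  have hHeq : ∀ s t, f s = f t → H s = H t := fun s t h =>
    tsum_congr fun n => by simp only [G, hFeq _ _ s t h]
  have hHlt : ∀ s t, s < t → f s ≠ f t → H s < H t := by
    intro s t hst h
    obtain ⟨i, j, h1, h2, h3, h4⟩ := exists_dense_pair hf hd hst h
    refine Summable.tsum_lt_tsum (i := (i, j)) (fun n => hGm n s t hst.le) ?_ (hGs s) (hGs t)
    obtain ⟨h5, h6⟩ := hFsep _ _ h2 h4
    have h7 := hFm (d i) (d j) h1
    have h8 := hFm (d i) (d j) h3
    refine mul_lt_mul_of_pos_left ?_ (hwpos _)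
    change F (d i) (d j) s < F (d i) (d j) t
    linarith
  have hHmono : Monotone H := fun s t hst =>
    Summable.tsum_le_tsum (fun n => hGm n s t hst) (hGs s) (hGs t)
  have hHinj : ∀ s t, H s = H t → f s = f t := by
    intro s t h
    by_contra hc
    rcases lt_trichotomy s t with hst | rfl | hst
    · exact (hHlt s t hst hc).ne h
    · exact hc rfl
    · exact (hHlt t s hst (Ne.symm hc)).ne h.symm
  have h01 : H 0 < H 1 := hHlt 0 1 (by exact zero_lt_one) hne
  have hD : 0 < H 1 - H 0 := sub_pos.2 h01
  let k : I → I := fun s => ⟨(H s - H 0) / (H 1 - H 0),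
    div_nonneg (sub_nonneg.2 (hHmono s.2.1)) hD.le,
    (div_le_one hD).2 (sub_le_sub_right (hHmono s.2.2) _)⟩
  have hkc : Continuous k := ((hHc.sub continuous_const).div_const _).subtype_mk _
  have hk0 : k 0 = 0 := Subtype.ext (by simp [k])
  have hk1 : k 1 = 1 := Subtype.ext (by simp [k, hD.ne'])
  have hksurj : Function.Surjective k := by
    intro v
    obtain ⟨s, -, hs⟩ := intermediate_value_Icc (zero_le_one : (0 : I) ≤ 1) hkc.continuousOn
      (show v ∈ Icc (k 0) (k 1) by rw [hk0, hk1]; exact ⟨v.2.1, v.2.2⟩)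
    exact ⟨s, hs⟩
  have hkH : ∀ s t, k s = k t ↔ H s = H t := by
    intro s t
    rw [Subtype.ext_iff]
    simp only [k]
    rw [div_left_inj' hD.ne', sub_left_inj]
  have hq : IsQuotientMap k := hkc.isClosedMap.isQuotientMap hkc hksurj
  choose ret hret using hksurj
  have hretf : ∀ s, f (ret (k s)) = f s := fun s => hHinj _ _ ((hkH _ _).1 (hret _))
  have hcomp : (fun v => f (ret v)) ∘ k = f := funext hretf
  refine ⟨fun v => f (ret v), ?_, ?_, ?_, ?_, ?_⟩
  · rw [hq.continuous_iff, hcomp]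
    exact hf
  · intro u v h
    have := (hkH _ _).2 (hHeq _ _ h)
    rwa [hret, hret] at this
  · rw [← hretf 0, hk0]
  · rw [← hretf 1, hk1]
  · rintro _ ⟨v, rfl⟩
    exact ⟨ret v, rfl⟩

/-- A closed subset of the unit interval containing both end points such that `γ` agrees at the two
end points of each of its gaps. -/
structure IsShortcut {T : Type*} (γ : I → T) (C : Set I) : Prop where
  isClosed : IsClosed C
  zero_mem : 0 ∈ C
  one_mem : 1 ∈ C
  eq_of_gap : ∀ s ∈ C, ∀ t ∈ C, s < t → Disjoint (Ioo s t) C → γ s = γ t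

namespace IsShortcut

variable {T : Type*} {γ : I → T} {C : Set I}

lemma exists_isGreatest (hC : IsShortcut γ C) (x : I) : ∃ l, IsGreatest (C ∩ Iic x) l :=
  (hC.isClosed.inter isClosed_Iic).isCompact.exists_isGreatest ⟨0, hC.zero_mem, x.2.1⟩

lemma exists_isLeast (hC : IsShortcut γ C) (x : I) : ∃ r, IsLeast (C ∩ Ici x) r :=
  (hC.isClosed.inter isClosed_Ici).isCompact.exists_isLeast ⟨1, hC.one_mem, x.2.2⟩

lemma disjoint_gap {x l r : I} (hl : IsGreatest (C ∩ Iic x) l)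
    (hr : IsLeast (C ∩ Ici x) r) : Disjoint (Ioo l r) C := by
  refine disjoint_left.2 fun z hz hzC => ?_
  rcases le_total z x with h | h
  · exact (hl.2 ⟨hzC, h⟩).not_gt hz.1
  · exact (hr.2 ⟨hzC, h⟩).not_gt hz.2

lemma eq_of_bounds (hC : IsShortcut γ C) {x l r : I} (hl : IsGreatest (C ∩ Iic x) l)
    (hr : IsLeast (C ∩ Ici x) r) : γ l = γ r := by
  rcases (hl.1.2.trans hr.1.2 : l ≤ r).eq_or_lt with h | h
  · rw [h]
  · exact hC.eq_of_gap l hl.1.1 r hr.1.1 h (disjoint_gap hl hr)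

lemma diff_Ioo (hC : IsShortcut γ C) {s t : I} (hs : s ∈ C) (ht : t ∈ C) (h : γ s = γ t) :
    IsShortcut γ (C \ Ioo s t) where
  isClosed := hC.isClosed.sdiff isOpen_Ioo
  zero_mem := ⟨hC.zero_mem, fun h => h.1.not_ge s.2.1⟩
  one_mem := ⟨hC.one_mem, fun h => h.2.not_ge t.2.2⟩
  eq_of_gap a ha b hb hab hd := by
    by_cases hd' : Disjoint (Ioo a b) C
    · exact hC.eq_of_gap a ha.1 b hb.1 hab hd'
    obtain ⟨z, hz, hzC⟩ := not_disjoint_iff.1 hd'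
    have hzst : z ∈ Ioo s t := by
      by_contra hc
      exact disjoint_left.1 hd hz ⟨hzC, hc⟩
    have has : a ≤ s := by
      by_contra! hc
      exact ha.2 ⟨hc, hz.1.trans hzst.2⟩
    have htb : t ≤ b := by
      by_contra! hc
      exact hb.2 ⟨hzst.1.trans hz.2, hc⟩
    have has' : a = s := has.eq_of_not_lt fun hc =>
      disjoint_left.1 hd ⟨hc, hzst.1.trans hz.2⟩ ⟨hs, fun h => h.1.false⟩
    have htb' : t = b := htb.eq_of_not_lt fun hc =>
      disjoint_left.1 hd ⟨hz.1.trans hzst.2, hc⟩ ⟨ht, fun h => h.2.false⟩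
    rw [has', ← htb', h]

lemma sInter_of_isChain [TopologicalSpace T] [T2Space T] (hγ : Continuous γ) {S : Set (Set I)}
    (hS : ∀ c ∈ S, IsShortcut γ c) (hchain : IsChain (· ⊆ ·) S) (hne : S.Nonempty) :
    IsShortcut γ (⋂₀ S) where
  isClosed := isClosed_sInter fun c hc => (hS c hc).isClosed
  zero_mem := fun c hc => (hS c hc).zero_mem
  one_mem := fun c hc => (hS c hc).one_mem
  eq_of_gap s hs t ht hst hd := by
    by_contra h
    obtain ⟨U, V, hU, hV, hsU, htV, hUV⟩ := t2_separation h
    obtain ⟨m, hsm, hmt⟩ := exists_between hst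
    obtain ⟨u, hu, hsu⟩ := exists_Ico_subset_of_mem_nhds ((hU.preimage hγ).mem_nhds hsU) ⟨t, hst⟩
    obtain ⟨v, hv, hvt⟩ := exists_Ioc_subset_of_mem_nhds ((hV.preimage hγ).mem_nhds htV) ⟨s, hst⟩
    obtain ⟨s', hs'⟩ := exists_between (lt_min hu hsm)
    obtain ⟨t', ht'⟩ := exists_between (max_lt hv hmt)
    have hs'2 := lt_min_iff.1 hs'.2
    have ht'1 := max_lt_iff.1 ht'.1
    obtain ⟨c, hcS, hc⟩ : ∃ c ∈ S, Disjoint (Icc s' t') c := by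
      have : Nonempty S := hne.to_subtype
      have hempty : Icc s' t' ∩ ⋂ c : S, (c : Set I) = ∅ := by
        rw [← sInter_eq_iInter, ← disjoint_iff_inter_eq_empty]
        exact hd.mono_left (Icc_subset_Ioo hs'.1 ht'.2)
      have hdir : Directed (· ⊇ ·) fun c : S => (c : Set I) := fun a b =>
        (hchain.total a.2 b.2).elim (fun h => ⟨a, Subset.rfl, h⟩) fun h => ⟨b, h, Subset.rfl⟩
      obtain ⟨c, hc⟩ := isCompact_Icc.elim_directed_family_closed
        (fun c : S => (c : Set I)) (fun c => (hS c c.2).isClosed) hempty hdir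
      exact ⟨c, c.2, disjoint_iff_inter_eq_empty.2 hc⟩
    obtain ⟨a, ha⟩ := (hS c hcS).exists_isGreatest m
    obtain ⟨b, hb⟩ := (hS c hcS).exists_isLeast m
    have hab := (hS c hcS).eq_of_bounds ha hb
    have hsa : s ≤ a := ha.2 ⟨hs c hcS, hsm.le⟩
    have hbt : b ≤ t := hb.2 ⟨ht c hcS, hmt.le⟩
    have has' : a < s' := by
      by_contra! h'
      exact disjoint_left.1 hc ⟨h', ha.1.2.trans ht'1.2.le⟩ ha.1.1
    have hbt' : t' < b := by
      by_contra! h'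
      exact disjoint_left.1 hc ⟨hs'2.2.le.trans hb.1.2, h'⟩ hb.1.1
    have h1 : γ a ∈ U := hsu ⟨hsa, has'.trans hs'2.1⟩
    have h2 : γ b ∈ V := hvt ⟨ht'1.1.trans hbt', hbt⟩
    exact disjoint_left.1 hUV h1 (hab ▸ h2)

lemma exists_minimal [TopologicalSpace T] [T2Space T] (hγ : Continuous γ) :
    ∃ C, Minimal (IsShortcut γ) C := by
  refine zorn_superset {C | IsShortcut γ C} fun S hS hchain => ?_
  rcases S.eq_empty_or_nonempty with rfl | hne
  · refine ⟨univ, ⟨isClosed_univ, trivial, trivial, fun s _ t _ hst hd => ?_⟩, by simp⟩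
    exact absurd (nonempty_Ioo.2 hst) (not_nonempty_iff_eq_empty.2 (disjoint_univ.1 hd))
  · exact ⟨⋂₀ S, sInter_of_isChain hγ hS hchain hne, fun c hc => sInter_subset_of_mem hc⟩

end IsShortcut

/-- A path with distinct end points in a Hausdorff space contains an arc between them. -/
theorem exists_injective_of_continuous {T : Type*} [TopologicalSpace T] [T2Space T]
    {γ : I → T} (hγ : Continuous γ) (hne : γ 0 ≠ γ 1) :
    ∃ p : I → T, Continuous p ∧ Function.Injective p ∧ p 0 = γ 0 ∧ p 1 = γ 1 ∧
      range p ⊆ range γ := by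
  obtain ⟨C, hC, hmin⟩ := IsShortcut.exists_minimal hγ
  have hgap : ∀ s ∈ C, ∀ t ∈ C, γ s = γ t → Disjoint (Ioo s t) C := fun s hs t ht h =>
    disjoint_left.2 fun z hz hzC => (hmin (hC.diff_Ioo hs ht h) sdiff_subset hzC).2 hz
  choose L hL using hC.exists_isGreatest
  choose R hR using hC.exists_isLeast
  have hLR : ∀ x, γ (L x) = γ (R x) := fun x => hC.eq_of_bounds (hL x) (hR x)
  have hLmem : ∀ x ∈ C, L x = x := fun x hx =>
    le_antisymm (hL x).1.2 ((hL x).2 ⟨hx, mem_Iic.2 le_rfl⟩)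
  have hLmono : Monotone L := fun x y hxy => (hL y).2 ⟨(hL x).1.1, (hL x).1.2.trans hxy⟩
  have hcont : Continuous fun x => γ (L x) := by
    rw [continuous_iff_continuousAt]
    intro x
    by_cases hx : x ∈ C
    · intro W hW
      simp only [hLmem x hx] at hW
      have hN := ordConnectedComponent_mem_nhds.2 (hγ.continuousAt hW)
      have hNc : (ordConnectedComponent (γ ⁻¹' W) x).OrdConnected := inferInstance
      have hNW : ordConnectedComponent (γ ⁻¹' W) x ⊆ γ ⁻¹' W := ordConnectedComponent_subset
      change ∀ᶠ y in 𝓝 x, γ (L y) ∈ W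
      filter_upwards [hN] with y hy
      have hxN := mem_of_mem_nhds hN
      rcases le_total x y with h | h
      · exact hNW (hNc.out hxN hy ⟨(hL y).2 ⟨hx, h⟩, (hL y).1.2⟩)
      · change γ (L y) ∈ W
        rw [hLR]
        exact hNW (hNc.out hy hxN ⟨(hR y).1.2, (hR y).2 ⟨hx, h⟩⟩)
    · have h1 : L x < x := (hL x).1.2.lt_of_ne fun h => hx (h ▸ (hL x).1.1)
      have h2 : x < R x := (hR x).1.2.lt_of_ne fun h => hx (h ▸ (hR x).1.1)
      refine continuousAt_const.congr (f := fun _ => γ (L x)) ?_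
      filter_upwards [Ioo_mem_nhds h1 h2] with y hy
      congr 1
      refine le_antisymm ((hL y).2 ⟨(hL x).1.1, hy.1.le⟩) ?_
      by_contra! h
      exact disjoint_left.1 (IsShortcut.disjoint_gap (hL x) (hR x))
        ⟨h, (hL y).1.2.trans_lt hy.2⟩ (hL y).1.1
  have h0 : L 0 = 0 := hLmem 0 hC.zero_mem
  have h1 : L 1 = 1 := hLmem 1 hC.one_mem
  obtain ⟨p, hp, hpi, hp0, hp1, hpr⟩ := exists_injective_of_ordConnected_fibers hcont
    (fun x z y hxz hzy h => by
      have hd := hgap _ (hL x).1.1 _ (hL y).1.1 h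
      rcases (hLmono hxz).eq_or_lt with h1 | h1
      · rw [h1]
      rcases (hLmono hzy).eq_or_lt with h2 | h2
      · rw [h2]; exact h.symm
      exact absurd (hL z).1.1 (disjoint_left.1 hd ⟨h1, h2⟩))
    (by rwa [h0, h1])
  refine ⟨p, hp, hpi, by rw [hp0, h0], by rw [hp1, h1], hpr.trans ?_⟩
  rintro _ ⟨x, rfl⟩
  exact ⟨L x, rfl⟩

/-- If any two arcs with the same end points have the same image, then an arc is contained in
every path with the same end points. -/
lemma range_subset_of_unique_arc {T : Type*} [TopologicalSpace T] [T2Space T]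
    (huniq : ∀ (x y : T) (p q : I → T),
      Continuous p → Function.Injective p → p 0 = x → p 1 = y →
      Continuous q → Function.Injective q → q 0 = x → q 1 = y → range p = range q)
    {x y : T} {p : I → T} (hp : Continuous p) (hpi : Function.Injective p)
    (hp0 : p 0 = x) (hp1 : p 1 = y) (γ : Path x y) : range p ⊆ range γ := by
  have hne : γ 0 ≠ γ 1 := by
    rw [γ.source, γ.target, ← hp0, ← hp1]
    exact hpi.ne zero_ne_one
  obtain ⟨q, hq, hqi, hq0, hq1, hqr⟩ := exists_injective_of_continuous γ.continuous hne
  rw [huniq x y p q hp hpi hp0 hp1 hq hqi (hq0.trans γ.source) (hq1.trans γ.target)]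
  exact hqr

lemma injective_comp_mul_left {T : Type*} {p : I → T} (hp : Function.Injective p) {t : I}
    (ht : t ≠ 0) : Function.Injective fun s => p (t * s) := fun a b h => by
  have h' : (t : ℝ) * a = t * b := congrArg Subtype.val (hp h)
  exact Subtype.ext (mul_left_cancel₀ (fun hc => ht (Subtype.ext hc)) h')


/-- In a Hausdorff, uniquely arcwise connected space `T`, for any nonempty closed
path-connected subset `X` and any point `y`, there is a unique point `c ∈ X` lying
on every arc from `y` to a point of `X` (the point of `X` closest to `y`). -/
theorem closest_point_unique_exists
    {T : Type*} [TopologicalSpace T] [T2Space T]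
    (harc : ∀ x y : T, x ≠ y → ∃ p : unitInterval → T,
      Continuous p ∧ Function.Injective p ∧ p 0 = x ∧ p 1 = y)
    (huniq : ∀ (x y : T) (p q : unitInterval → T),
      Continuous p → Function.Injective p → p 0 = x → p 1 = y →
      Continuous q → Function.Injective q → q 0 = x → q 1 = y →
      Set.range p = Set.range q)
    (X : Set T) (hXne : X.Nonempty) (hXclosed : IsClosed X)
    (hXpath : IsPathConnected X) (y : T) :
    ∃! c : T, c ∈ X ∧ ∀ x ∈ X, ∀ p : unitInterval → T,
      Continuous p → Function.Injective p → p 0 = y → p 1 = x →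
      c ∈ Set.range p := by
  have hrestr : ∀ c ∈ X, (∀ x ∈ X, ∀ p : I → T, Continuous p → Function.Injective p →
      p 0 = y → p 1 = x → c ∈ range p) → ∀ A : I → T, Continuous A → Function.Injective A →
      A 0 = y → A 1 = c → ∀ s, s ≠ 0 → s ≠ 1 → A s ∉ X := by
    intro c _ hc A hA hAi hA0 hA1 s hs0 hs1 hsX
    obtain ⟨r, hr⟩ := hc (A s) hsX (fun r => A (s * r)) (hA.comp (continuous_const.mul continuous_id))
      (injective_comp_mul_left hAi hs0) (by simp [hA0]) (by simp)
    have h1 : s * r = 1 := hAi (hr.trans hA1.symm)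
    exact hs1 (le_antisymm s.2.2 (h1 ▸ unitInterval.mul_le_left))
  have hatmost : ∀ c c' : T, c ∈ X → c' ∈ X →
      (∀ x ∈ X, ∀ p : I → T, Continuous p → Function.Injective p →
        p 0 = y → p 1 = x → c ∈ range p) →
      (∀ x ∈ X, ∀ p : I → T, Continuous p → Function.Injective p →
        p 0 = y → p 1 = x → c' ∈ range p) → c ≠ y → c' = c := by
    intro c c' hcX hc'X hc hc' hcy
    by_contra hcc
    obtain ⟨A, hA, hAi, hA0, hA1⟩ := harc y c hcy.symm
    have hout := hrestr c hcX hc A hA hAi hA0 hA1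
    obtain ⟨s, rfl⟩ := hc' c hcX A hA hAi hA0 hA1
    by_cases hs0 : s = 0
    · subst hs0
      rw [hA0] at hc'X
      obtain ⟨γ, hγ⟩ := hXpath.joinedIn y hc'X c hcX
      obtain ⟨m, hm0, hm1⟩ := exists_between (zero_lt_one : (0 : I) < 1)
      refine hout m hm0.ne' hm1.ne ?_
      obtain ⟨r, hr⟩ := range_subset_of_unique_arc huniq hA hAi hA0 hA1 γ ⟨m, rfl⟩
      exact hr ▸ hγ r
    · exact hout s hs0 (fun h => hcc (h ▸ hA1)) hc'X
  refine existsUnique_of_exists_of_unique ?_ ?_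
  · by_cases hy : y ∈ X
    · exact ⟨y, hy, fun x _ p _ _ hp0 _ => ⟨0, hp0⟩⟩
    obtain ⟨x₀, hx₀⟩ := hXne
    obtain ⟨p, hp, hpi, hp0, hp1⟩ := harc y x₀ (fun h => hy (h ▸ hx₀))
    obtain ⟨t, htX, htmin⟩ := (hXclosed.preimage hp).isCompact.exists_isLeast
      ⟨1, show p 1 ∈ X from hp1 ▸ hx₀⟩
    have ht0 : t ≠ 0 := by
      rintro rfl
      exact hy (hp0 ▸ htX)
    refine ⟨p t, htX, fun x hx q hq hqi hq0 hq1 => ?_⟩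
    obtain ⟨γ, hγ⟩ := hXpath.joinedIn x hx (p t) htX
    let δ : Path y x := ⟨⟨q, hq⟩, hq0, hq1⟩
    have hsub := range_subset_of_unique_arc huniq (p := fun r => p (t * r))
      (hp.comp (continuous_const.mul continuous_id)) (injective_comp_mul_left hpi ht0)
      (by simp [hp0]) (by simp) (δ.trans γ)
    rw [Path.trans_range] at hsub
    have hlt : ∀ r : I, r < 1 → p (t * r) ∈ range q := by
      intro r hr
      rcases hsub ⟨r, rfl⟩ with h | ⟨v, hv⟩
      · exact h
      · have hle : t ≤ t * r := htmin (show p (t * r) ∈ X by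
          have hv' : γ v = p (t * r) := hv
          exact hv' ▸ hγ v)
        have hle' : (t : ℝ) ≤ t * r := hle
        have hr' : (r : ℝ) < 1 := hr
        have ht' : (0 : ℝ) < t := lt_of_le_of_ne t.2.1 fun h => ht0 (Subtype.ext h.symm)
        nlinarith
    have hcl : IsClosed ((fun r : I => p (t * r)) ⁻¹' range q) :=
      (isCompact_range hq).isClosed.preimage (hp.comp (continuous_const.mul continuous_id))
    have h1 : (1 : I) ∈ closure (Iio 1) := by
      rw [closure_Iio' ⟨0, zero_lt_one⟩]
      exact mem_Iic.2 le_rfl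
    have := hcl.closure_subset_iff.2 (fun r hr => hlt r hr) h1
    simpa using this
  · rintro c c' ⟨hcX, hc⟩ ⟨hc'X, hc'⟩
    by_cases hcy : c = y
    · by_cases hcy' : c' = y
      · rw [hcy, hcy']
      · exact hatmost c' c hc'X hcX hc' hc hcy'
    · exact (hatmost c c' hcX hc'X hc hc' hcy).symm
end

section
/- Let T be a Hausdorff, uniquely arcwise connected topological space, let X ⊆ T be a nonempty, closed, path-connected subset, and let y ∈ T with y ∉ X. If c ∈ X is a point such that for every x ∈ X, every injective continuous map p : [0,1] → T with p(0) = y and p(1) = x has c in its range, then c lies in the topological boundary (frontier) of X. -/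
/-- In a Hausdorff, uniquely arcwise connected space `T`, if `X` is a nonempty closed
path-connected subset, `y ∉ X`, and `c ∈ X` lies on every arc from `y` to a point of
`X`, then `c` lies in the frontier of `X`. -/
theorem closest_point_mem_frontier
    {T : Type*} [TopologicalSpace T] [T2Space T]
    (harc : ∀ x y : T, x ≠ y → ∃ p : unitInterval → T,
      Continuous p ∧ Function.Injective p ∧ p 0 = x ∧ p 1 = y)
    (huniq : ∀ (x y : T) (p q : unitInterval → T),
      Continuous p → Function.Injective p → p 0 = x → p 1 = y →
      Continuous q → Function.Injective q → q 0 = x → q 1 = y →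
      Set.range p = Set.range q)
    (X : Set T) (hXne : X.Nonempty) (hXclosed : IsClosed X)
    (hXpath : IsPathConnected X) (y : T) (hy : y ∉ X)
    (c : T) (hc : c ∈ X)
    (hclosest : ∀ x ∈ X, ∀ p : unitInterval → T,
      Continuous p → Function.Injective p → p 0 = y → p 1 = x →
      c ∈ Set.range p) :
    c ∈ frontier X := by
  refine ⟨subset_closure hc, fun hint => ?_⟩
  obtain ⟨p, hp, hinj, h0, h1⟩ := harc y c (ne_of_mem_of_not_mem hc hy).symm
  have hev : ∀ᶠ t in nhds (1 : unitInterval), p t ∈ interior X :=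
    hp.continuousAt.eventually_mem (by rw [h1]; exact isOpen_interior.mem_nhds hint)
  have : (nhdsWithin (1 : unitInterval) (Set.Iio 1)).NeBot :=
    nhdsLT_neBot_of_exists_lt ⟨0, zero_lt_one⟩
  obtain ⟨t, ht, ht1⟩ : ∃ t, p t ∈ interior X ∧ t ∈ Set.Iio (1 : unitInterval) :=
    ((hev.filter_mono nhdsWithin_le_nhds).and eventually_mem_nhdsWithin).exists
  have htX : p t ∈ X := interior_subset ht
  have ht0 : t ≠ 0 := by
    rintro rfl
    exact hy (h0 ▸ htX)
  obtain ⟨s, hs⟩ := hclosest (p t) htX (fun s => p (s * t)) (by fun_prop)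
    (fun a b hab => mul_right_cancel₀ ht0 (hinj hab)) (by simp [h0]) (by simp)
  have hst : s * t = 1 := hinj (hs.trans h1.symm)
  have hle : s * t ≤ t := unitInterval.mul_le_right
  exact (hst ▸ hle).not_gt ht1
end

section
/- Let T be a Hausdorff, uniquely arcwise connected topological space, let X ⊆ T be a nonempty, closed, path-connected subset, and let y ∈ T with y ∉ X. Then there exist a point c ∈ X and an injective continuous map p : [0,1] → T with p(0) = y and p(1) = c such that the range of p intersects X exactly in the singleton {c}. -/
/-- An arc that starts outside a closed set and ends in it can be cut off at the first point
where it meets the set. -/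
theorem exists_arc_inter_closed_eq_singleton {T : Type*} [TopologicalSpace T] {X : Set T}
    (hX : IsClosed X) {p : unitInterval → T} (hp : Continuous p)
    (hinj : Function.Injective p) (h0 : p 0 ∉ X) (h1 : p 1 ∈ X) :
    ∃ (c : T) (q : unitInterval → T), c ∈ X ∧
      Continuous q ∧ Function.Injective q ∧ q 0 = p 0 ∧ q 1 = c ∧
      Set.range q ∩ X = {c} := by
  obtain ⟨t, htX, hmin⟩ := (hX.preimage hp).isCompact.exists_isLeast ⟨1, h1⟩
  have ht0 : t ≠ 0 := fun h => h0 (h ▸ htX)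
  refine ⟨p t, fun s => p (t * s), htX, by fun_prop, ?_, by simp, by simp, ?_⟩
  · exact hinj.comp (mul_right_injective₀ ht0)
  · ext z
    constructor
    · rintro ⟨⟨s, rfl⟩, hs⟩
      exact congrArg p (le_antisymm unitInterval.mul_le_left (hmin hs))
    · rintro rfl
      exact ⟨⟨1, by simp⟩, htX⟩

/-- In a Hausdorff, uniquely arcwise connected space `T`, if `X` is a nonempty closed
path-connected subset and `y ∉ X`, then there is a point `c ∈ X` and an arc from `y`
to `c` meeting `X` exactly in `{c}`. -/
theorem arc_meets_closed_set_in_singleton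
    {T : Type*} [TopologicalSpace T] [T2Space T]
    (harc : ∀ x y : T, x ≠ y → ∃ p : unitInterval → T,
      Continuous p ∧ Function.Injective p ∧ p 0 = x ∧ p 1 = y)
    (huniq : ∀ (x y : T) (p q : unitInterval → T),
      Continuous p → Function.Injective p → p 0 = x → p 1 = y →
      Continuous q → Function.Injective q → q 0 = x → q 1 = y →
      Set.range p = Set.range q)
    (X : Set T) (hXne : X.Nonempty) (hXclosed : IsClosed X)
    (hXpath : IsPathConnected X) (y : T) (hy : y ∉ X) :
    ∃ (c : T) (p : unitInterval → T), c ∈ X ∧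
      Continuous p ∧ Function.Injective p ∧ p 0 = y ∧ p 1 = c ∧
      Set.range p ∩ X = {c} := by
  obtain ⟨x, hx⟩ := hXne
  obtain ⟨p, hp, hinj, rfl, rfl⟩ := harc y x (ne_of_mem_of_not_mem hx hy).symm
  exact exists_arc_inter_closed_eq_singleton hXclosed hp hinj hy hx
end

section
/- Let T be a Hausdorff, uniquely arcwise connected topological space, and let A ⊆ T be a path-connected subset. If x, y ∈ A are distinct and p : [0,1] → T is an injective continuous map with p(0) = x and p(1) = y, then the range of p is contained in A. (In a uniquely arcwise connected Hausdorff space, the arc joining two points of a path-connected set lies in that set.) -/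
open Set Filter Topology

section ArcInPath

variable {α T : Type*} [LinearOrder α] [TopologicalSpace α]

/-- A closed set containing the endpoints such that `γ` takes equal values at the two ends of
each of its gaps. -/
structure IsLoopSkeleton [BoundedOrder α] (γ : α → T) (K : Set α) : Prop where
  isClosed : IsClosed K
  bot_mem : ⊥ ∈ K
  top_mem : ⊤ ∈ K
  eq_of_gap : ∀ a ∈ K, ∀ b ∈ K, a < b → (∀ c ∈ K, c ≤ a ∨ b ≤ c) → γ a = γ b

theorem IsLoopSkeleton.exists_isGreatest [BoundedOrder α] [OrderTopology α]
    [CompactSpace α] {γ : α → T} {K : Set α} (hK : IsLoopSkeleton γ K)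
    (t : α) : ∃ k, IsGreatest (K ∩ Iic t) k :=
  (hK.isClosed.inter isClosed_Iic).isCompact.exists_isGreatest ⟨⊥, hK.bot_mem, bot_le⟩

theorem IsLoopSkeleton.exists_isLeast [BoundedOrder α] [OrderTopology α]
    [CompactSpace α] {γ : α → T} {K : Set α} (hK : IsLoopSkeleton γ K)
    (t : α) : ∃ k, IsLeast (K ∩ Ici t) k :=
  (hK.isClosed.inter isClosed_Ici).isCompact.exists_isLeast ⟨⊤, hK.top_mem, le_top⟩

theorem IsLoopSkeleton.sInter [BoundedOrder α] [OrderTopology α] [CompactSpace α]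
    [DenselyOrdered α] [TopologicalSpace T] [T2Space T] {γ : α → T} (hγ : Continuous γ)
    {c : Set (Set α)}
    (hc : ∀ K ∈ c, IsLoopSkeleton γ K) (hchain : IsChain (· ⊆ ·) c) (hne : c.Nonempty) :
    IsLoopSkeleton γ (⋂₀ c) := by
  refine ⟨isClosed_sInter fun K hK => (hc K hK).isClosed, fun K hK => (hc K hK).bot_mem,
    fun K hK => (hc K hK).top_mem, fun a ha b hb hab hgap => ?_⟩
  by_contra hne'
  obtain ⟨U, V, hU, hV, haU, hbV, hUV⟩ := t2_separation hne'
  obtain ⟨a', ⟨haa', ha'b⟩, ha'⟩ := (mem_nhdsGE_iff_exists_mem_Ioc_Ico_subset hab).1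
    (mem_nhdsWithin_of_mem_nhds (hγ.continuousAt (hU.mem_nhds haU)))
  obtain ⟨a₁, haa₁, ha₁⟩ := exists_between haa'
  obtain ⟨b', ⟨hb'a, hb'b⟩, hb'⟩ :=
    (mem_nhdsLE_iff_exists_mem_Ico_Ioc_subset (ha₁.trans_le ha'b)).1
      (mem_nhdsWithin_of_mem_nhds (hγ.continuousAt (hV.mem_nhds hbV)))
  obtain ⟨b₁, hb'b₁, hb₁b⟩ := exists_between hb'b
  obtain ⟨K, hKc, hK⟩ : ∃ K ∈ c, Icc a₁ b₁ ∩ K = ∅ := by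
    have : Nonempty c := hne.to_subtype
    obtain ⟨K, hK⟩ := (isClosed_Icc (a := a₁) (b := b₁)).isCompact.elim_directed_family_closed
      (fun K : c => (K : Set α)) (fun K => (hc K K.2).isClosed)
      (by
        rw [← sInter_eq_iInter]
        ext z
        simp only [mem_inter_iff, mem_empty_iff_false, iff_false, not_and]
        intro hz hz'
        rcases hgap z hz' with h | h
        · exact absurd (haa₁.trans_le hz.1) h.not_gt
        · exact absurd (hz.2.trans_lt hb₁b) h.not_gt)
      (fun K L => by
        rcases hchain.total K.2 L.2 with h | h
        · exact ⟨K, le_rfl, h⟩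
        · exact ⟨L, h, le_rfl⟩)
    exact ⟨K, K.2, hK⟩
  have hK' : ∀ z ∈ K, z < a₁ ∨ b₁ < z := fun z hz => by
    by_contra! h
    exact (hK.le ⟨⟨h.1, h.2⟩, hz⟩ : z ∈ (∅ : Set α))
  obtain ⟨k, ⟨hkK, hk⟩, hk'⟩ := (hc K hKc).exists_isGreatest a₁
  obtain ⟨l, ⟨hlK, hl⟩, hl'⟩ := (hc K hKc).exists_isLeast b₁
  have h1 : γ k ∈ U := ha' ⟨hk' ⟨ha K hKc, haa₁.le⟩, (show k ≤ a₁ from hk).trans_lt ha₁⟩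
  have h2 : γ l ∈ V := hb' ⟨hb'b₁.trans_le hl, hl' ⟨hb K hKc, hb₁b.le⟩⟩
  have hkl : γ k = γ l := (hc K hKc).eq_of_gap k hkK l hlK
    ((show k ≤ a₁ from hk).trans_lt ((hb'a.trans_lt hb'b₁).trans_le hl)) fun z hz =>
      (hK' z hz).imp (fun h => hk' ⟨hz, h.le⟩) (fun h => hl' ⟨hz, h.le⟩)
  exact disjoint_left.1 hUV h1 (hkl ▸ h2)

theorem IsLoopSkeleton.diff_Ioo [BoundedOrder α] [OrderTopology α] {γ : α → T} {K : Set α}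
    (hK : IsLoopSkeleton γ K) {s t : α}
    (hs : s ∈ K) (ht : t ∈ K) (hst : γ s = γ t) : IsLoopSkeleton γ (K \ Ioo s t) := by
  refine ⟨hK.isClosed.sdiff isOpen_Ioo, ⟨hK.bot_mem, fun h => not_lt_bot h.1⟩,
    ⟨hK.top_mem, fun h => not_top_lt h.2⟩, fun a ha b hb hab hgap => ?_⟩
  by_cases h : ∀ c ∈ K, c ≤ a ∨ b ≤ c
  · exact hK.eq_of_gap a ha.1 b hb.1 hab h
  push Not at h
  obtain ⟨c, hcK, hac, hcb⟩ := h
  have hc : c ∈ Ioo s t := by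
    by_contra hc
    rcases hgap c ⟨hcK, hc⟩ with h | h
    · exact h.not_gt hac
    · exact h.not_gt hcb
  have h1 := hgap s ⟨hs, fun h => lt_irrefl _ h.1⟩
  have h2 := hgap t ⟨ht, fun h => lt_irrefl _ h.2⟩
  have ha2 := ha.2
  have hb2 := hb.2
  simp only [mem_Ioo] at *
  have has : a = s := by grind
  have hbt : b = t := by grind
  rw [has, hbt, hst]

/-- Every path in a Hausdorff space can be replaced, without leaving its range, by one with
order-connected fibers and the same endpoints. -/
theorem exists_continuous_ordConnected_fibers [BoundedOrder α] [OrderTopology α] [CompactSpace α]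
    [DenselyOrdered α] [TopologicalSpace T] [T2Space T] {γ : α → T} (hγ : Continuous γ) :
    ∃ δ : α → T, Continuous δ ∧ δ ⊥ = γ ⊥ ∧ δ ⊤ = γ ⊤ ∧ range δ ⊆ range γ ∧
      ∀ s u t, s ≤ u → u ≤ t → δ s = δ t → δ u = δ s := by
  obtain ⟨K, hKmin⟩ := zorn_superset {K | IsLoopSkeleton γ K} fun c hc hchain => by
    rcases c.eq_empty_or_nonempty with rfl | hne
    · refine ⟨univ, ⟨isClosed_univ, trivial, trivial, fun a _ b _ hab h => ?_⟩, by simp⟩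
      obtain ⟨z, haz, hzb⟩ := exists_between hab
      rcases h z trivial with h | h
      · exact absurd haz h.not_gt
      · exact absurd hzb h.not_gt
    · exact ⟨_, IsLoopSkeleton.sInter hγ hc hchain hne, fun K hK => sInter_subset_of_mem hK⟩
  have hK : IsLoopSkeleton γ K := hKmin.prop
  have hgap : ∀ s ∈ K, ∀ t ∈ K, γ s = γ t → ∀ u ∈ K, s ≤ u → u ≤ t → u = s ∨ u = t := by
    intro s hs t ht hst u hu hsu hut
    have := hKmin.le_of_le (hK.diff_Ioo hs ht hst) sdiff_subset hu
    have h := this.2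
    simp only [mem_Ioo] at h
    grind
  choose k hk using hK.exists_isGreatest
  choose l hl using hK.exists_isLeast
  have hkmono : Monotone k := fun s t hst => (hk t).2 ⟨(hk s).1.1, (hk s).1.2.trans hst⟩
  have hkself : ∀ t ∈ K, k t = t := fun t ht => le_antisymm (hk t).1.2 ((hk t).2 ⟨ht, le_rfl⟩)
  have hlself : ∀ t ∈ K, l t = t := fun t ht => le_antisymm ((hl t).2 ⟨ht, le_rfl⟩) (hl t).1.2
  have hkl : ∀ t, γ (k t) = γ (l t) := by
    intro t
    rcases ((hk t).1.2.trans (hl t).1.2 : k t ≤ l t).eq_or_lt with h | h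
    · rw [h]
    · exact hK.eq_of_gap _ (hk t).1.1 _ (hl t).1.1 h fun z hz =>
        (le_total z t).imp (fun h => (hk t).2 ⟨hz, h⟩) (fun h => (hl t).2 ⟨hz, h⟩)
  refine ⟨γ ∘ k, ?_, ?_, ?_, range_comp_subset_range _ _, ?_⟩
  · rw [continuous_iff_continuousAt]
    intro t
    by_cases ht : t ∈ K
    · have hright : Tendsto k (𝓝[≥] t) (𝓝 t) :=
        tendsto_of_tendsto_of_tendsto_of_le_of_le' tendsto_const_nhds
          (tendsto_id.mono_left nhdsWithin_le_nhds)
          (eventually_mem_nhdsWithin.mono fun s hs => (hk s).2 ⟨ht, hs⟩)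
          (Eventually.of_forall fun s => (hk s).1.2)
      have hleft : Tendsto l (𝓝[≤] t) (𝓝 t) :=
        tendsto_of_tendsto_of_tendsto_of_le_of_le' (tendsto_id.mono_left nhdsWithin_le_nhds)
          tendsto_const_nhds (Eventually.of_forall fun s => (hl s).1.2)
          (eventually_mem_nhdsWithin.mono fun s hs => (hl s).2 ⟨ht, hs⟩)
      rw [ContinuousAt, Function.comp_apply, hkself t ht, ← nhdsLE_sup_nhdsGE]
      exact (((hγ.tendsto t).comp hleft).congr fun s => (hkl s).symm).sup
        ((hγ.tendsto t).comp hright)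
    · have hkt : k t < t := lt_of_le_of_ne (hk t).1.2 fun h => ht (h ▸ (hk t).1.1)
      have hlt : t < l t := lt_of_le_of_ne (hl t).1.2 fun h => ht (h ▸ (hl t).1.1)
      refine (continuousAt_const (y := γ (k t))).congr ?_
      filter_upwards [Ioo_mem_nhds hkt hlt] with s hs
      refine congrArg γ (le_antisymm ((hk s).2 ⟨(hk t).1.1, hs.1.le⟩) ((hk t).2 ⟨(hk s).1.1, ?_⟩))
      by_contra h
      exact (((hl t).2 ⟨(hk s).1.1, (not_le.1 h).le⟩).trans (hk s).1.2).not_gt hs.2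
  · simp [hkself _ hK.bot_mem]
  · simp [hkself _ hK.top_mem]
  · intro s u t hsu hut hst
    rcases hgap _ (hk s).1.1 _ (hk t).1.1 hst _ (hk u).1.1 (hkmono hsu) (hkmono hut) with h | h
    · simp [h]
    · simp only [Function.comp_apply] at *
      rw [h, hst]

theorem exists_monotone_zero_one [OrderTopology α] [CompactSpace α] [TopologicalSpace T]
    [CompactSpace T] [T2Space T]
    {δ : α → T} (hδ : Continuous δ)
    (hfib : ∀ s u t, s ≤ u → u ≤ t → δ s = δ t → δ u = δ s) {q r : α} (hqr : q < r)
    (hne : δ q ≠ δ r) :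
    ∃ M : α → ℝ, Continuous M ∧ Monotone M ∧ (∀ t, M t ∈ Icc 0 1) ∧
      (∀ s t, δ s = δ t → M s = M t) ∧ (∀ t ≤ q, M t = 0) ∧ ∀ t, r ≤ t → M t = 1 := by
  have hdisj : Disjoint (δ '' Iic q) (δ '' Ici r) := by
    rw [disjoint_left]
    rintro _ ⟨a, ha, rfl⟩ ⟨b, hb, hab⟩
    exact hne ((hfib a q b ha (hqr.le.trans hb) hab.symm).trans
      (hfib a r b ((show a ≤ q from ha).trans hqr.le) hb hab.symm).symm)
  obtain ⟨g, hg0, hg1, hg⟩ := exists_continuous_zero_one_of_isClosed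
    (isClosed_Iic.isCompact.image hδ).isClosed (isClosed_Ici.isCompact.image hδ).isClosed hdisj
  set M : α → ℝ := fun t => sSup ((fun s => g (δ (min s t))) '' univ) with hM
  have hbdd : ∀ t, BddAbove ((fun s => g (δ (min s t))) '' univ) := fun t =>
    ⟨1, by rintro _ ⟨s, -, rfl⟩; exact (hg _).2⟩
  have hle : ∀ s t, s ≤ t → g (δ s) ≤ M t := fun s t hst =>
    le_csSup (hbdd t) ⟨s, trivial, by simp [hst]⟩
  have hMle : ∀ t c, (∀ s ≤ t, g (δ s) ≤ c) → M t ≤ c := fun t c h =>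
    csSup_le ⟨_, t, trivial, rfl⟩ (by rintro _ ⟨s, -, rfl⟩; exact h _ (min_le_right _ _))
  have hmono : Monotone M := fun s t hst => hMle _ _ fun u hu => hle u t (hu.trans hst)
  have h01 : ∀ t, M t ∈ Icc (0 : ℝ) 1 := fun t =>
    ⟨(hg _).1.trans (hle t t le_rfl), hMle _ _ fun s _ => (hg _).2⟩
  have hcongr : ∀ s t, s ≤ t → δ s = δ t → M s = M t := fun s t hst h =>
    le_antisymm (hmono hst) <| hMle _ _ fun u hu => by
      rcases le_total u s with hus | hus
      · exact hle u s hus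
      · rw [hfib s u t hus hu h]
        exact hle s s le_rfl
  refine ⟨M, ?_, hmono, h01, fun s t h => ?_, fun t ht => ?_, fun t ht => ?_⟩
  · exact isCompact_univ.continuous_sSup (f := fun t s => g (δ (min s t))) (by fun_prop)
  · rcases le_total s t with hst | hst
    · exact hcongr s t hst h
    · exact (hcongr t s hst h.symm).symm
  · exact le_antisymm (hMle _ _ fun s hs => (hg0 ⟨s, hs.trans ht, rfl⟩).le) (h01 t).1
  · exact le_antisymm (h01 t).2 ((hg1 ⟨t, ht, rfl⟩).ge.trans (hle t t le_rfl))

theorem exists_lt_lt_ne [OrderTopology α] [DenselyOrdered α] [TopologicalSpace T] [T2Space T]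
    {δ : α → T} (hδ : Continuous δ) {D : Set α} (hD : Dense D)
    {s t : α} (hst : s < t) (hne : δ s ≠ δ t) :
    ∃ q ∈ D, ∃ r ∈ D, s < q ∧ q < r ∧ r < t ∧ δ q ≠ δ r := by
  obtain ⟨U, V, hU, hV, hsU, htV, hUV⟩ := t2_separation hne
  obtain ⟨a, ⟨hsa, hat⟩, ha⟩ := (mem_nhdsGE_iff_exists_mem_Ioc_Ico_subset hst).1
    (mem_nhdsWithin_of_mem_nhds (hδ.continuousAt (hU.mem_nhds hsU)))
  obtain ⟨q, hqD, hsq, hqa⟩ := hD.exists_between hsa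
  obtain ⟨b, ⟨hqb, hbt⟩, hb⟩ := (mem_nhdsLE_iff_exists_mem_Ico_Ioc_subset (hqa.trans_le hat)).1
    (mem_nhdsWithin_of_mem_nhds (hδ.continuousAt (hV.mem_nhds htV)))
  obtain ⟨r, hrD, hbr, hrt⟩ := hD.exists_between hbt
  exact ⟨q, hqD, r, hrD, hsq, hqb.trans_lt hbr, hrt, fun h =>
    disjoint_left.1 hUV (ha ⟨hsq.le, hqa⟩) (h ▸ hb ⟨hbr, hrt.le⟩)⟩

theorem exists_monotone_same_fibers [OrderTopology α] [CompactSpace α] [DenselyOrdered α]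
    [TopologicalSpace.SeparableSpace α] [TopologicalSpace T] [CompactSpace T] [T2Space T]
    {δ : α → T} (hδ : Continuous δ)
    (hfib : ∀ s u t, s ≤ u → u ≤ t → δ s = δ t → δ u = δ s) :
    ∃ φ : α → ℝ, Continuous φ ∧ Monotone φ ∧ ∀ s t, φ s = φ t ↔ δ s = δ t := by
  obtain ⟨D, hDc, hD⟩ := TopologicalSpace.exists_countable_dense α
  have : Countable D := hDc.to_subtype
  have : Encodable (D × D) := Encodable.ofCountable _
  have hex : ∀ i : D × D, ∃ M : α → ℝ, Continuous M ∧ Monotone M ∧ (∀ t, M t ∈ Icc 0 1) ∧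
      (∀ s t, δ s = δ t → M s = M t) ∧ ((i.1 : α) < i.2 → δ i.1 ≠ δ i.2 →
        (∀ t ≤ (i.1 : α), M t = 0) ∧ ∀ t, (i.2 : α) ≤ t → M t = 1) := by
    intro i
    by_cases h : (i.1 : α) < i.2 ∧ δ i.1 ≠ δ i.2
    · obtain ⟨M, h1, h2, h3, h4, h5⟩ := exists_monotone_zero_one hδ hfib h.1 h.2
      exact ⟨M, h1, h2, h3, h4, fun _ _ => h5⟩
    · exact ⟨fun _ => 0, continuous_const, monotone_const, by simp, by simp,
        fun h1 h2 => absurd ⟨h1, h2⟩ h⟩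
  choose M hMc hMm hM01 hMδ hM using hex
  let w : D × D → ℝ := fun i => (1 / 2) ^ Encodable.encode i
  have hw : Summable w := summable_geometric_two_encode
  have hwpos : ∀ i, 0 < w i := fun i => by positivity
  have hbound : ∀ i t, ‖w i * M i t‖ ≤ w i := fun i t => by
    rw [Real.norm_of_nonneg (mul_nonneg (hwpos i).le (hM01 i t).1)]
    exact mul_le_of_le_one_right (hwpos i).le (hM01 i t).2
  have hsum : ∀ t, Summable fun i => w i * M i t := fun t =>
    Summable.of_norm_bounded hw fun i => hbound i t
  have hterm : ∀ i, Monotone fun t => w i * M i t := fun i s t hst =>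
    mul_le_mul_of_nonneg_left (hMm i hst) (hwpos i).le
  have hmono : Monotone fun t => ∑' i, w i * M i t := fun s t hst =>
    (hsum s).tsum_le_tsum (fun i => hterm i hst) (hsum t)
  have hlt : ∀ s t, s < t → δ s ≠ δ t → ∑' i, w i * M i s < ∑' i, w i * M i t := by
    intro s t hst hne
    obtain ⟨q, hq, r, hr, hsq, hqr, hrt, hqr'⟩ := exists_lt_lt_ne hδ hD hst hne
    refine Summable.tsum_lt_tsum (i := (⟨q, hq⟩, ⟨r, hr⟩)) (fun i => hterm i hst.le) ?_
      (hsum s) (hsum t)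
    obtain ⟨h0, h1⟩ := hM (⟨q, hq⟩, ⟨r, hr⟩) hqr hqr'
    rw [h0 s hsq.le, h1 t hrt.le]
    simpa using hwpos _
  refine ⟨_, continuous_tsum (fun i => (hMc i).const_mul _) hw hbound, hmono,
    fun s t => ⟨fun h => ?_, fun h => tsum_congr fun i => by rw [hMδ i s t h]⟩⟩
  by_contra hne
  rcases lt_trichotomy s t with hst | rfl | hst
  · exact (hlt s t hst hne).ne h
  · exact hne rfl
  · exact (hlt t s hst (Ne.symm hne)).ne' h

end ArcInPath

/-- The range of a path between distinct points of a Hausdorff space contains an arc between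
them. -/
theorem exists_injective_range_subset {T : Type*} [TopologicalSpace T] [T2Space T]
    {γ : unitInterval → T} (hγ : Continuous γ) (hne : γ 0 ≠ γ 1) :
    ∃ q : unitInterval → T, Continuous q ∧ Function.Injective q ∧ q 0 = γ 0 ∧ q 1 = γ 1 ∧
      range q ⊆ range γ := by
  obtain ⟨δ, hδ, hδ0, hδ1, hrange, hfib⟩ := exists_continuous_ordConnected_fibers hγ
  change δ 0 = γ 0 at hδ0
  change δ 1 = γ 1 at hδ1
  have : CompactSpace (range δ) := isCompact_iff_compactSpace.1 (isCompact_range hδ)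
  obtain ⟨φ, hφ, hmono, hφδ⟩ := exists_monotone_same_fibers (δ := rangeFactorization δ)
    (hδ.subtype_mk _) (fun s u t h1 h2 h => Subtype.ext (hfib s u t h1 h2 (congrArg Subtype.val h)))
  replace hφδ : ∀ s t, φ s = φ t ↔ δ s = δ t := fun s t =>
    (hφδ s t).trans Subtype.ext_iff
  have hlt : φ 0 < φ 1 := (hmono zero_le_one).lt_of_ne fun h => hne <| by
    rw [← hδ0, ← hδ1]; exact (hφδ 0 1).1 h
  let e := iccHomeoI (φ 0) (φ 1) hlt
  let ψ : unitInterval → unitInterval := fun t => e ⟨φ t, hmono t.2.1, hmono t.2.2⟩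
  have hψ : Continuous ψ := e.continuous.comp (hφ.subtype_mk _)
  have hψδ : ∀ s t, ψ s = ψ t ↔ δ s = δ t := fun s t => by
    rw [← hφδ]; exact e.injective.eq_iff.trans Subtype.mk_eq_mk
  have hψ0 : ψ 0 = 0 := by
    ext; simp [ψ, e]
  have hψ1 : ψ 1 = 1 := by
    ext; simp [ψ, e, (sub_pos.2 hlt).ne']
  have hsurj : Function.Surjective ψ := fun u => by
    obtain ⟨t, -, ht⟩ := intermediate_value_Icc (zero_le_one' unitInterval) hψ.continuousOn
      (show u ∈ Icc (ψ 0) (ψ 1) by rw [hψ0, hψ1]; exact ⟨u.2.1, u.2.2⟩)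
    exact ⟨t, ht⟩
  have hq : ∀ t, δ (Function.surjInv hsurj (ψ t)) = δ t := fun t =>
    (hψδ _ _).1 (Function.surjInv_eq hsurj _)
  refine ⟨δ ∘ Function.surjInv hsurj, ?_, fun u v h => ?_, ?_, ?_,
    (range_comp_subset_range _ _).trans hrange⟩
  · rw [(hψ.isClosedMap.isQuotientMap hψ hsurj).continuous_iff]
    exact hδ.congr fun t => (hq t).symm
  · rw [← Function.surjInv_eq hsurj u, ← Function.surjInv_eq hsurj v]
    exact (hψδ _ _).2 h
  · rw [← hδ0, ← hq 0, hψ0]; rfl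
  · rw [← hδ1, ← hq 1, hψ1]; rfl

/-- In a Hausdorff, uniquely arcwise connected space `T`, the arc joining two distinct
points of a path-connected subset `A` lies inside `A`. -/
theorem arc_subset_of_pathConnected
    {T : Type*} [TopologicalSpace T] [T2Space T]
    (harc : ∀ x y : T, x ≠ y → ∃ p : unitInterval → T,
      Continuous p ∧ Function.Injective p ∧ p 0 = x ∧ p 1 = y)
    (huniq : ∀ (x y : T) (p q : unitInterval → T),
      Continuous p → Function.Injective p → p 0 = x → p 1 = y →
      Continuous q → Function.Injective q → q 0 = x → q 1 = y →
      Set.range p = Set.range q)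
    (A : Set T) (hApath : IsPathConnected A)
    (x y : T) (hx : x ∈ A) (hy : y ∈ A) (hxy : x ≠ y)
    (p : unitInterval → T) (hp : Continuous p) (hpinj : Function.Injective p)
    (hp0 : p 0 = x) (hp1 : p 1 = y) :
    Set.range p ⊆ A := by
  obtain ⟨γ, hγ⟩ := hApath.joinedIn x hx y hy
  obtain ⟨q, hq, hqinj, hq0, hq1, hqγ⟩ := exists_injective_range_subset γ.continuous
    (by simpa using hxy)
  rw [huniq x y p q hp hpinj hp0 hp1 hq hqinj (by simpa using hq0) (by simpa using hq1)]
  exact hqγ.trans (range_subset_iff.2 hγ)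
end

section
/- Let K be a field with a nonarchimedean absolute value, and let g, h ∈ K[X] with g(0) = 0 and h(0) ≠ 0; set λ := g'(0)/h(0) and assume ‖λ‖ ≠ 1. Then there exists ε > 0 with the following property: for every b ∈ K and every real ρ with 0 < ‖b‖ < ε and 0 ≤ ρ < ‖b‖, and for every y in the closed ball closedBall b ρ, one has h(y) ≠ 0 and g(y)/h(y) ∉ closedBall b ρ. In particular the map y ↦ g(y)/h(y) carries every closed disk near 0 but not containing 0 entirely off of itself, so 0 is an isolated fixed point. -/
open Polynomial Metric

/-- In an ultrametric normed group, every point of a closed ball not containing `0` has the same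
norm as the center. -/
theorem norm_eq_of_mem_closedBall_of_lt_norm {E : Type*} [SeminormedAddCommGroup E]
    [IsUltrametricDist E] {b y : E} {ρ : ℝ} (hρ : ρ < ‖b‖) (hy : y ∈ closedBall b ρ) :
    ‖y‖ = ‖b‖ := by
  rw [mem_closedBall, dist_eq_norm] at hy
  have hlt : ‖y - b‖ < ‖b‖ := hy.trans_lt hρ
  simpa [max_eq_right hlt.le] using IsUltrametricDist.norm_add_eq_max_of_norm_ne_norm hlt.ne

/-- If the multiplier `λ = g'(0)/h(0)` at the fixed point `0` satisfies `‖λ‖ ≠ 1`,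
then `g/h` carries every small closed disk near `0` (but not containing `0`)
entirely off of itself; in particular `0` is an isolated fixed point. -/
theorem attracting_repelling_isolated
    {K : Type*} [NormedField K] [IsUltrametricDist K]
    (g h : K[X]) (hg0 : g.eval 0 = 0) (hh0 : h.eval 0 ≠ 0)
    (hlam : ‖g.derivative.eval 0 / h.eval 0‖ ≠ 1) :
    ∃ ε > (0 : ℝ), ∀ b : K, ∀ ρ : ℝ,
      0 < ‖b‖ → ‖b‖ < ε → 0 ≤ ρ → ρ < ‖b‖ →
      ∀ y ∈ closedBall b ρ,
        h.eval y ≠ 0 ∧ g.eval y / h.eval y ∉ closedBall b ρ := by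
  obtain ⟨q, rfl⟩ : X ∣ g := by rwa [X_dvd_iff, coeff_zero_eq_eval_zero]
  have hlam' : ‖q.eval 0 / h.eval 0‖ ≠ 1 := by simpa using hlam
  have hcont : ContinuousAt (fun y => ‖q.eval y / h.eval y‖) 0 :=
    (q.continuousAt.div h.continuousAt hh0).norm
  obtain ⟨ε, hε, hball⟩ := Metric.eventually_nhds_iff.mp
    ((h.continuousAt.eventually_ne hh0).and (hcont.eventually_ne hlam'))
  refine ⟨ε, hε, fun b ρ hb hbε _ hρ y hy => ?_⟩
  have hyb := norm_eq_of_mem_closedBall_of_lt_norm hρ hy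
  obtain ⟨hhy, hqy⟩ := hball (y := y) (by rwa [dist_zero_right, hyb])
  refine ⟨hhy, fun hmem => hqy ?_⟩
  have hfy := norm_eq_of_mem_closedBall_of_lt_norm hρ hmem
  rw [eval_mul, eval_X, mul_div_assoc, norm_mul, hyb] at hfy
  exact (mul_eq_left₀ hb.ne').mp hfy
end

section
/- Let K be a field with a nonarchimedean absolute value, and let g, h ∈ K[X] with g(0) = 0 and h(0) ≠ 0; set λ := g'(0)/h(0) and assume ‖λ‖ < 1. Then there exist ε > 0 and a real c with 0 ≤ c < 1 such that: (i) for all y ∈ K with ‖y‖ < ε one has h(y) ≠ 0 and ‖g(y)/h(y)‖ ≤ c·‖y‖; and (ii) every sequence (y_n) in K with ‖y_0‖ < ε and y_{n+1} = g(y_n)/h(y_n) for all n tends to 0. -/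
open Polynomial

/-- If the multiplier `λ = g'(0)/h(0)` at the fixed point `0` satisfies `‖λ‖ < 1`,
then `g/h` is a contraction near `0` and every forward orbit starting near `0`
tends to `0`. -/
theorem attracting_orbits_tendsto
    {K : Type*} [NormedField K] [IsUltrametricDist K]
    (g h : K[X]) (hg0 : g.eval 0 = 0) (hh0 : h.eval 0 ≠ 0)
    (hlam : ‖g.derivative.eval 0 / h.eval 0‖ < 1) :
    ∃ ε > (0 : ℝ), ∃ c : ℝ, 0 ≤ c ∧ c < 1 ∧
      (∀ y : K, ‖y‖ < ε →
        h.eval y ≠ 0 ∧ ‖g.eval y / h.eval y‖ ≤ c * ‖y‖) ∧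
      (∀ y : ℕ → K, ‖y 0‖ < ε →
        (∀ n : ℕ, y (n + 1) = g.eval (y n) / h.eval (y n)) →
        Filter.Tendsto y Filter.atTop (nhds 0)) := by
  obtain ⟨q, rfl⟩ : X ∣ g := X_dvd_iff.2 (by rwa [coeff_zero_eq_eval_zero])
  have hq : (X * q).derivative.eval 0 = q.eval 0 := by simp
  rw [hq] at hlam
  obtain ⟨c, hc, hc1⟩ := exists_between hlam
  have hc0 : 0 ≤ c := (norm_nonneg _).trans hc.le
  have hcont : ContinuousAt (fun y => ‖q.eval y / h.eval y‖) 0 :=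
    (q.continuousAt.div h.continuousAt hh0).norm
  obtain ⟨ε, hε, hball⟩ := Metric.eventually_nhds_iff.1
    ((h.continuousAt.eventually_ne hh0).and (hcont.eventually_lt_const hc))
  have hcontr : ∀ y : K, ‖y‖ < ε →
      h.eval y ≠ 0 ∧ ‖(X * q).eval y / h.eval y‖ ≤ c * ‖y‖ := by
    intro y hy
    obtain ⟨hne, hlt⟩ := hball (by rwa [dist_zero_right])
    refine ⟨hne, ?_⟩
    rw [eval_mul, eval_X, mul_div_assoc, norm_mul, mul_comm]
    gcongr
  refine ⟨ε, hε, c, hc0, hc1, hcontr, fun y hy0 hy => ?_⟩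
  have hbound : ∀ n, ‖y n‖ ≤ c ^ n * ‖y 0‖ := by
    intro n
    induction n with
    | zero => simp
    | succ n ih =>
      have hlt : ‖y n‖ < ε := ih.trans_lt <|
        (mul_le_of_le_one_left (norm_nonneg _) (pow_le_one₀ hc0 hc1.le)).trans_lt hy0
      rw [hy n, pow_succ', mul_assoc]
      exact (hcontr _ hlt).2.trans (mul_le_mul_of_nonneg_left ih hc0)
  refine squeeze_zero_norm hbound ?_
  simpa using (tendsto_pow_atTop_nhds_zero_of_lt_one hc0 hc1).mul_const ‖y 0‖
end

section
/- Let K be a complete field with a nonarchimedean absolute value, and let g, h ∈ K[X] with g(0) = 0 and h(0) ≠ 0; set λ := g'(0)/h(0) and assume ‖λ‖ = 1. Then there exists ε > 0 such that for every real r with 0 < r < ε, the polynomial h has no zero in closedBall 0 r and the map y ↦ g(y)/h(y) is a bijection of closedBall 0 r onto itself (Set.BijOn on closedBall 0 r). In particular every sufficiently small closed disk around an indifferent fixed point is invariant as a set. -/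
open Polynomial Metric

/-- A map fixing `0` that differs from multiplication by a scalar of norm one by a
`1/2`-Lipschitz error on `closedBall 0 r` is a bijection of that ball. -/
theorem bijOn_closedBall_of_norm_sub_sub_mul_le
    {K : Type*} [NormedField K] [IsUltrametricDist K] [CompleteSpace K]
    {f : K → K} {a : K} {r : ℝ} (hr : 0 ≤ r) (hf0 : f 0 = 0) (ha : ‖a‖ = 1)
    (hf : ∀ y ∈ closedBall (0 : K) r, ∀ z ∈ closedBall (0 : K) r,
      ‖f y - f z - a * (y - z)‖ ≤ 1 / 2 * ‖y - z‖) :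
    Set.BijOn f (closedBall 0 r) (closedBall 0 r) := by
  have ha0 : a ≠ 0 := norm_pos_iff.1 (by rw [ha]; exact one_pos)
  have h0 : (0 : K) ∈ closedBall (0 : K) r := mem_closedBall_self hr
  have herr : ∀ y ∈ closedBall (0 : K) r, ‖f y - a * y‖ ≤ r := fun y hy => by
    have h1 := hf y hy 0 h0
    simp only [hf0, sub_zero] at h1
    have h2 := mem_closedBall_zero_iff.1 hy
    linarith [norm_nonneg y]
  refine ⟨fun y hy => ?_, fun y hy z hz hyz => ?_, fun w hw => ?_⟩
  · have h1 := IsUltrametricDist.norm_add_le_max (f y - a * y) (a * y)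
    rw [sub_add_cancel, norm_mul, ha, one_mul] at h1
    exact mem_closedBall_zero_iff.2
      (h1.trans (max_le (herr y hy) (mem_closedBall_zero_iff.1 hy)))
  · have h1 := hf y hy z hz
    rw [sub_eq_zero.2 hyz, zero_sub, norm_neg, norm_mul, ha, one_mul] at h1
    exact sub_eq_zero.1 (norm_le_zero_iff.1 (by linarith))
  · -- A preimage of `w` is a fixed point of the Newton-type map `y ↦ a⁻¹ * (w - (f y - a * y))`.
    have hmaps : Set.MapsTo (fun y => a⁻¹ * (w - (f y - a * y)))
        (closedBall (0 : K) r) (closedBall 0 r) := fun y hy => by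
      have h1 := IsUltrametricDist.norm_add_le_max w (-(f y - a * y))
      rw [← sub_eq_add_neg, norm_neg] at h1
      rw [mem_closedBall_zero_iff, norm_mul, norm_inv, ha, inv_one, one_mul]
      exact h1.trans (max_le (mem_closedBall_zero_iff.1 hw) (herr y hy))
    have hcontr : ContractingWith (1 / 2) (hmaps.restrict _ _ _) := by
      refine ⟨by norm_num, LipschitzWith.of_dist_le_mul fun y z => ?_⟩
      rw [Subtype.dist_eq, Subtype.dist_eq, dist_eq_norm, dist_eq_norm]
      simp only [Set.MapsTo.val_restrict_apply]
      have h1 : a⁻¹ * (w - (f y - a * y)) - a⁻¹ * (w - (f z - a * z))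
          = -(a⁻¹ * (f y - f z - a * (y - z))) := by ring
      rw [h1, norm_neg, norm_mul, norm_inv, ha, inv_one, one_mul]
      simpa using hf y y.2 z z.2
    obtain ⟨y, hy, hfix, -⟩ := ContractingWith.exists_fixedPoint'
      isClosed_closedBall.isComplete hmaps hcontr h0 (edist_ne_top _ _)
    refine ⟨y, hy, ?_⟩
    have h1 : a⁻¹ * (w - (f y - a * y)) = y := hfix
    rw [inv_mul_eq_iff_eq_mul₀ ha0] at h1
    linear_combination -h1

/-- Near a zero of `g`, a quotient `g / h` of polynomials with `h` nonvanishing is strictly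
approximated by its derivative. The norm may be trivial. -/
theorem exists_norm_div_sub_div_sub_mul_le
    {K : Type*} [NormedField K] (g h : K[X]) (hg0 : g.eval 0 = 0) (hh0 : h.eval 0 ≠ 0)
    {c : ℝ} (hc : 0 < c) :
    ∃ ε > (0 : ℝ), ∀ y ∈ ball (0 : K) ε, h.eval y ≠ 0 ∧ ∀ z ∈ ball (0 : K) ε,
      ‖g.eval y / h.eval y - g.eval z / h.eval z
        - g.derivative.eval 0 / h.eval 0 * (y - z)‖ ≤ c * ‖y - z‖ := by
  by_cases hK : ∃ x : K, x ≠ 0 ∧ ‖x‖ ≠ 1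
  · let _ := NontriviallyNormedField.ofNormNeOne hK
    have hderiv := (g.hasStrictDerivAt 0).fun_div (h.hasStrictDerivAt 0) hh0
    have hval : (g.derivative.eval 0 * h.eval 0 - g.eval 0 * h.derivative.eval 0)
        / h.eval 0 ^ 2 = g.derivative.eval 0 / h.eval 0 := by
      rw [hg0]
      field_simp
      ring
    rw [hval] at hderiv
    have happrox := (hasStrictFDerivAt_iff_isLittleO.1 hderiv.hasStrictFDerivAt).def hc
    obtain ⟨δ, hδ, hδ'⟩ := Metric.eventually_nhds_iff_ball.1 happrox
    obtain ⟨η, hη, hη'⟩ := Metric.eventually_nhds_iff_ball.1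
      (h.continuous.continuousAt.eventually_ne hh0)
    refine ⟨min δ η, lt_min hδ hη, fun y hy =>
      ⟨hη' y (ball_subset_ball (min_le_right _ _) hy), fun z hz => ?_⟩⟩
    have hyz : (y, z) ∈ ball ((0 : K), (0 : K)) δ := by
      rw [← ball_prod_same]
      exact ⟨ball_subset_ball (min_le_left _ _) hy, ball_subset_ball (min_le_left _ _) hz⟩
    simpa [mul_comm] using hδ' _ hyz
  · push Not at hK
    have hzero : ∀ y ∈ ball (0 : K) 1, y = 0 := fun y hy => by
      by_contra hy0
      exact (mem_ball_zero_iff.1 hy).ne (hK y hy0)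
    refine ⟨1, one_pos, fun y hy => ?_⟩
    rw [hzero y hy]
    refine ⟨hh0, fun z hz => ?_⟩
    rw [hzero z hz]
    simp

/-- If `K` is complete and the multiplier `λ = g'(0)/h(0)` at the fixed point `0`
satisfies `‖λ‖ = 1`, then every sufficiently small closed disk around `0` contains no
zero of `h` and is mapped bijectively onto itself by `g/h`. -/
theorem indifferent_disk_invariant
    {K : Type*} [NormedField K] [IsUltrametricDist K] [CompleteSpace K]
    (g h : K[X]) (hg0 : g.eval 0 = 0) (hh0 : h.eval 0 ≠ 0)
    (hlam : ‖g.derivative.eval 0 / h.eval 0‖ = 1) :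
    ∃ ε > (0 : ℝ), ∀ r : ℝ, 0 < r → r < ε →
      (∀ y ∈ closedBall (0 : K) r, h.eval y ≠ 0) ∧
      Set.BijOn (fun y => g.eval y / h.eval y)
        (closedBall (0 : K) r) (closedBall (0 : K) r) := by
  obtain ⟨ε, hε, hball⟩ :=
    exists_norm_div_sub_div_sub_mul_le g h hg0 hh0 (one_half_pos (α := ℝ))
  refine ⟨ε, hε, fun r hr hrε => ?_⟩
  have hsub : closedBall (0 : K) r ⊆ ball 0 ε := closedBall_subset_ball hrε
  exact ⟨fun y hy => (hball y (hsub hy)).1,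
    bijOn_closedBall_of_norm_sub_sub_mul_le hr.le (by simp [hg0]) hlam
      fun y hy z hz => (hball y (hsub hy)).2 z (hsub hz)⟩
end

section
/- Let K be a field with a nonarchimedean absolute value, let g, h ∈ K[X], and let s be a natural number. Assume: every coefficient of g and of h has norm at most 1; ‖coeff g i‖ < 1 for all i ≤ s; ‖coeff g (s+1)‖ = 1; ‖coeff h j‖ < 1 for all j < s; and ‖coeff h s‖ = 1. Then there exists a real r₀ with 0 ≤ r₀ < 1 such that for all y ∈ K with r₀ < ‖y‖ < 1, one has h(y) ≠ 0 and ‖g(y)/h(y)‖ = ‖y‖. (On an annulus approaching the boundary sphere, the rational map g/h preserves the norm; this is the analytic core of the Second Indifference Lemma for a fixed direction with nonzero multiplier.) -/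
open Polynomial

/-- If the coefficients of `p` have norm at most one and the first one of norm one is in degree
`n`, then that term dominates `p.eval y` for `‖y‖` close to one from below. -/
lemma Polynomial.eventually_norm_eval_eq_pow
    {K : Type*} [NormedField K] [IsUltrametricDist K] (p : K[X]) (n : ℕ)
    (hcoeff : ∀ i : ℕ, ‖p.coeff i‖ ≤ 1) (hlow : ∀ i : ℕ, i < n → ‖p.coeff i‖ < 1)
    (htop : ‖p.coeff n‖ = 1) :
    ∀ᶠ r in nhdsWithin (1 : ℝ) (Set.Iio 1), ∀ y : K, ‖y‖ = r → ‖p.eval y‖ = ‖y‖ ^ n := by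
  have hpow : Filter.Tendsto (fun r : ℝ => r ^ n) (nhdsWithin 1 (Set.Iio 1)) (nhds 1) := by
    have hc : ContinuousAt (fun r : ℝ => r ^ n) 1 := by fun_prop
    simpa [ContinuousAt] using hc.tendsto.mono_left nhdsWithin_le_nhds
  have hdom : ∀ᶠ r in nhdsWithin (1 : ℝ) (Set.Iio 1), ∀ i ∈ Finset.range n,
      ‖p.coeff i‖ < r ^ n := by
    rw [Filter.eventually_all_finset]
    intro i hi
    exact hpow.eventually_const_lt (hlow i (Finset.mem_range.mp hi))
  have hpos : ∀ᶠ r in nhdsWithin (1 : ℝ) (Set.Iio 1), 0 < r :=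
    nhdsWithin_le_nhds (lt_mem_nhds one_pos)
  filter_upwards [hdom, hpos, self_mem_nhdsWithin] with r hdom hpos hlt y hy
  have hlt : r < 1 := hlt
  have hn : n ∈ Finset.range (p.natDegree + 1) := by
    rw [Finset.mem_range, Nat.lt_succ_iff]
    apply le_natDegree_of_ne_zero
    rw [← norm_ne_zero_iff, htop]
    exact one_ne_zero
  have hterm : ‖p.coeff n * y ^ n‖ = ‖y‖ ^ n := by rw [norm_mul, norm_pow, htop, one_mul]
  rw [eval_eq_sum_range, ← hterm]
  refine IsUltrametricDist.isNonarchimedean_norm.apply_sum_eq_of_lt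
    (f := fun x : K => ‖x‖) (fun a => (norm_neg a).symm) hn fun i _ hi => ?_
  rw [hterm, norm_mul, norm_pow, hy]
  rcases lt_or_gt_of_ne hi with hin | hin
  · calc ‖p.coeff i‖ * r ^ i ≤ ‖p.coeff i‖ :=
          mul_le_of_le_one_right (norm_nonneg _) (pow_le_one₀ hpos.le hlt.le)
      _ < r ^ n := hdom i (Finset.mem_range.mpr hin)
  · calc ‖p.coeff i‖ * r ^ i ≤ r ^ i := mul_le_of_le_one_left (pow_nonneg hpos.le i) (hcoeff i)
      _ < r ^ n := pow_lt_pow_right_of_lt_one₀ hpos hlt hin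

/-- Analytic core of the Second Indifference Lemma: if the reductions of `g` and `h`
are `λ̃·z^{s+1}` and `z^s` up to the stated coefficient conditions, then on an annulus
`r₀ < ‖y‖ < 1` approaching the boundary sphere, the rational map `g/h` preserves the
norm: `‖g(y)/h(y)‖ = ‖y‖`. -/
theorem annulus_norm_preserving
    {K : Type*} [NormedField K] [IsUltrametricDist K]
    (g h : K[X]) (s : ℕ)
    (hgint : ∀ i : ℕ, ‖g.coeff i‖ ≤ 1)
    (hhint : ∀ i : ℕ, ‖h.coeff i‖ ≤ 1)
    (hglow : ∀ i : ℕ, i ≤ s → ‖g.coeff i‖ < 1)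
    (hgtop : ‖g.coeff (s + 1)‖ = 1)
    (hhlow : ∀ j : ℕ, j < s → ‖h.coeff j‖ < 1)
    (hhtop : ‖h.coeff s‖ = 1) :
    ∃ r₀ : ℝ, 0 ≤ r₀ ∧ r₀ < 1 ∧
      ∀ y : K, r₀ < ‖y‖ → ‖y‖ < 1 →
        h.eval y ≠ 0 ∧ ‖g.eval y / h.eval y‖ = ‖y‖ := by
  obtain ⟨a, ha, hsub⟩ := mem_nhdsLT_iff_exists_Ioo_subset.mp
    ((g.eventually_norm_eval_eq_pow (s + 1) hgint
      (fun i hi => hglow i (Nat.lt_succ_iff.mp hi)) hgtop).and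
      (h.eventually_norm_eval_eq_pow s hhint hhlow hhtop))
  refine ⟨max a 0, le_max_right _ _, max_lt ha one_pos, fun y hy hy1 => ?_⟩
  obtain ⟨hay, hy0⟩ := max_lt_iff.mp hy
  obtain ⟨hg, hh⟩ := hsub ⟨hay, hy1⟩
  have hg := hg y rfl
  have hh := hh y rfl
  have hne : ‖y‖ ^ s ≠ 0 := (pow_pos hy0 s).ne'
  refine ⟨norm_ne_zero_iff.mp (hh ▸ hne), ?_⟩
  rw [norm_div, hg, hh, pow_succ, mul_div_cancel_left₀ _ hne]
end
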